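/- Let n ≥ 4 and let G be a finite simple graph that is Ramsey for K_n. Suppose a 2-colouring of the edges of G contains no monochromatic copy of K_n + K_{n-1}. Then, in this colouring, there do not exist two vertex sets S and S', each a monochromatic K_n (each in some colour), with |S ∩ S'| = 2. -/

import Mathlib

open Finset

/-- `S` is a monochromatic `K_m` in colour `b`: it has exactly `m` vertices,
its vertices are pairwise adjacent in `G`, and every edge inside `S` has colour `b`. -/
def IsMonoClique {V : Type*} (G : SimpleGraph V) (c : V → V → Bool) (b : Bool)
    (m : ℕ) (S : Finset V) : Prop :=
  S.card = m ∧ (∀ x ∈ S, ∀ y ∈ S, x ≠ y → G.Adj x y) ∧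
    (∀ x ∈ S, ∀ y ∈ S, x ≠ y → c x y = b)

/-- `G` is Ramsey for `K n`: every symmetric 2-colouring of the edges of `G`
contains a monochromatic `K n` in some colour. -/
def IsRamseyFor {V : Type*} (G : SimpleGraph V) (n : ℕ) : Prop :=
  ∀ c : V → V → Bool, (∀ x y, c x y = c y x) →
    ∃ b S, IsMonoClique G c b n S

/-- `G` is Ramsey for `K n + K m`: every symmetric 2-colouring of the edges of `G`
contains, in some colour `b`, two disjoint vertex sets that are a monochromatic `K n`
and a monochromatic `K m` in colour `b`. -/
def IsRamseyForPair {V : Type*} (G : SimpleGraph V) (n m : ℕ) : Prop :=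
  ∀ c : V → V → Bool, (∀ x y, c x y = c y x) →
    ∃ b S T, Disjoint S T ∧ IsMonoClique G c b n S ∧ IsMonoClique G c b m T

/-- `U` has `n - 1` vertices, and `S` assigns to each of them other than `u₀` the set `insert a U`,
while `u₀` is assigned a set that misses `a`. -/
structure IsTruncated {V : Type*} [DecidableEq V] (n : ℕ) (U : Finset V) (S : V → Finset V)
    (u₀ a : V) : Prop where
  mem : u₀ ∈ U
  card : U.card = n - 1
  notMem : a ∉ S u₀
  eq_insert : ∀ u ∈ U, u ≠ u₀ → S u = insert a U

theorem IsMonoClique.mono {V : Type*} {G : SimpleGraph V} {c : V → V → Bool} {b : Bool}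
    {m k : ℕ} {S T : Finset V} (h : IsMonoClique G c b m S) (hT : T ⊆ S) (hk : T.card = k) :
    IsMonoClique G c b k T :=
  ⟨hk, fun x hx y hy => h.2.1 x (hT hx) y (hT hy), fun x hx y hy => h.2.2 x (hT hx) y (hT hy)⟩

/-- The recoloured graph has no monochromatic `K n` in colour `b`, provided that the recolouring
`d` of `c` behaves as prescribed with respect to the sets `U` and `W`. -/
theorem not_isMonoClique_of_recolouring {α : Type*} [DecidableEq α] {G : SimpleGraph α} {n : ℕ}
    (hn : 4 ≤ n) {c d : α → α → Bool} {b : Bool} {U W : Finset α}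
    (hUW : Disjoint U W) {S T : α → Finset α}
    (hno : ∀ S T, Disjoint S T → IsMonoClique G c b n S → ¬ IsMonoClique G c b (n - 1) T)
    (hS : ∀ u ∈ U, IsMonoClique G c b n (S u)) (hT : ∀ w ∈ W, IsMonoClique G c (!b) n (T w))
    (hUU : ∀ x ∈ U, ∀ y ∈ U, d x y = !b)
    (hUX : ∀ u ∈ U, ∀ x, x ∉ U → x ∉ W → d u x = b → x ∉ S u)
    (hWX : ∀ w ∈ W, ∀ x, x ∉ U → x ∉ W → d w x = b → x ∈ T w)
    (hXX : ∀ x y, x ∉ U → x ∉ W → y ∉ U → y ∉ W → d x y = c x y)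
    (hcover : ∀ K, IsMonoClique G c b n K → ∃ x ∈ K, x ∈ U ∨ x ∈ W)
    (hW : W.card ≤ 1 ∨ ∃ w₀ x₀, IsTruncated n W T w₀ x₀ ∧
      ∀ u ∈ U, ∃ w ∈ W, w ≠ w₀ ∧ d u w = !b)
    (K : Finset α) : ¬ IsMonoClique G d b n K := by
  rintro ⟨hcard, hadj, hcol⟩
  have hU1 : (K ∩ U).card ≤ 1 := by
    refine card_le_one.2 fun x hx y hy => ?_
    simp only [mem_inter] at hx hy
    by_contra hxy
    have h1 := hcol x hx.1 y hy.1 hxy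
    rw [hUU x hx.2 y hy.2] at h1
    simp at h1
  by_cases hKW : ∀ x ∈ K, x ∉ W
  · by_cases hKU : ∀ x ∈ K, x ∉ U
    · obtain ⟨x, hx, hx'⟩ := hcover K ⟨hcard, hadj, fun x hx y hy hxy => by
        rw [← hXX x y (hKU x hx) (hKW x hx) (hKU y hy) (hKW y hy)]
        exact hcol x hx y hy hxy⟩
      exact hx'.elim (hKU x hx) (hKW x hx)
    · push Not at hKU
      obtain ⟨u, huK, huU⟩ := hKU
      have hX : ∀ x ∈ K.erase u, x ∈ K ∧ x ∉ U ∧ x ≠ u := by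
        intro x hx
        rw [mem_erase] at hx
        exact ⟨hx.2, fun hxU => hx.1 (card_le_one.1 hU1 x (mem_inter.2 ⟨hx.2, hxU⟩) u
          (mem_inter.2 ⟨huK, huU⟩)), hx.1⟩
      refine hno (S u) (K.erase u) ?_ (hS u huU) ⟨by rw [card_erase_of_mem huK, hcard], ?_, ?_⟩
      · refine disjoint_right.2 fun x hx => ?_
        obtain ⟨hxK, hxU, hxu⟩ := hX x hx
        exact hUX u huU x hxU (hKW x hxK) (hcol u huK x hxK hxu.symm)
      · exact fun x hx y hy => hadj x (hX x hx).1 y (hX y hy).1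
      · intro x hx y hy hxy
        obtain ⟨hxK, hxU, -⟩ := hX x hx
        obtain ⟨hyK, hyU, -⟩ := hX y hy
        rw [← hXX x y hxU (hKW x hxK) hyU (hKW y hyK)]
        exact hcol x hxK y hyK hxy
  · push Not at hKW
    obtain ⟨w, hwK, hwW⟩ := hKW
    have hX1 : ((K \ U) \ W).card ≤ 1 := by
      refine card_le_one.2 fun x hx y hy => ?_
      simp only [mem_sdiff] at hx hy
      by_contra hxy
      have h1 := hcol x hx.1.1 y hy.1.1 hxy
      have hxT := hWX w hwW x hx.1.2 hx.2 (hcol w hwK x hx.1.1 fun h => hx.2 (h ▸ hwW))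
      have hyT := hWX w hwW y hy.1.2 hy.2 (hcol w hwK y hy.1.1 fun h => hy.2 (h ▸ hwW))
      rw [hXX x y hx.1.2 hx.2 hy.1.2 hy.2, (hT w hwW).2.2 x hxT y hyT hxy] at h1
      simp at h1
    have hsum : n ≤ (K ∩ U).card + (K ∩ W).card + ((K \ U) \ W).card := by
      rw [← hcard]
      refine le_trans (card_le_card fun x hx => ?_)
        ((card_union_le ((K ∩ U) ∪ (K ∩ W)) _).trans (Nat.add_le_add_right (card_union_le _ _) _))
      simp only [mem_union, mem_inter, mem_sdiff]
      tauto
    obtain hW | ⟨w₀, x₀, htr, hrow⟩ := hW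
    · have := card_le_card (inter_subset_right : K ∩ W ⊆ W)
      omega
    have hle : (K ∩ W).card ≤ n - 1 := htr.card ▸ card_le_card inter_subset_right
    have key : W.erase w₀ ⊆ K ∧ (K ∩ U).Nonempty := by
      by_cases hX0 : ((K \ U) \ W).card = 0
      · have hKW : K ∩ W = W := eq_of_subset_of_card_le inter_subset_right (by
          rw [htr.card]; omega)
        exact ⟨(erase_subset _ _).trans (inter_eq_right.1 hKW), card_pos.1 (by omega)⟩
      · obtain ⟨x, hx⟩ := card_pos.1 (Nat.pos_of_ne_zero hX0)
        simp only [mem_sdiff] at hx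
        have hxT : ∀ v ∈ K ∩ W, x ∈ T v := fun v hv =>
          hWX v (mem_inter.1 hv).2 x hx.1.2 hx.2
            (hcol v (mem_inter.1 hv).1 x hx.1.1 fun h => hx.2 (h ▸ (mem_inter.1 hv).2))
        obtain ⟨v, hv, hvw⟩ := exists_mem_ne (show 1 < (K ∩ W).card by omega) w₀
        have hxx : x = x₀ := by
          have := hxT v hv
          rw [htr.eq_insert v (mem_inter.1 hv).2 hvw, mem_insert] at this
          exact this.resolve_right hx.2
        have hw₀ : w₀ ∉ K := fun h =>
          htr.notMem (hxx ▸ hxT w₀ (mem_inter.2 ⟨h, htr.mem⟩))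
        have hsub : K ∩ W ⊆ W.erase w₀ := fun y hy =>
          mem_erase.2 ⟨fun h => hw₀ (h ▸ (mem_inter.1 hy).1), (mem_inter.1 hy).2⟩
        have hc : (W.erase w₀).card = n - 2 := by
          rw [card_erase_of_mem htr.mem, htr.card]; omega
        have hc' := card_le_card hsub
        have heq : K ∩ W = W.erase w₀ := eq_of_subset_of_card_le hsub (by omega)
        exact ⟨heq ▸ inter_subset_left, card_pos.1 (by omega)⟩
    obtain ⟨hsub, u, hu⟩ := key
    rw [mem_inter] at hu
    obtain ⟨v, hvW, hvw, hv⟩ := hrow u hu.2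
    have hvK := hsub (mem_erase.2 ⟨hvw, hvW⟩)
    rw [hcol u hu.1 v hvK fun h => disjoint_left.1 hUW hu.2 (h ▸ hvW)] at hv
    simp at hv

/-- If disjoint sets `U` and `W` together meet every monochromatic `K n`, where `U` is truncated
and `W` is truncated or has at most one vertex, with respect to families of monochromatic `K n` of
opposite colours, then recolouring all edges meeting `U ∪ W` destroys every monochromatic `K n`. -/
theorem not_isRamseyFor_of_isTruncated {α : Type*} [DecidableEq α] {G : SimpleGraph α} {n : ℕ}
    (hn : 4 ≤ n) {c : α → α → Bool} (hc : ∀ u v, c u v = c v u)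
    (hno : ∀ b S T, Disjoint S T → IsMonoClique G c b n S → ¬ IsMonoClique G c b (n - 1) T)
    {b : Bool} {U W : Finset α} (hUW : Disjoint U W) {S T : α → Finset α}
    (hS : ∀ u ∈ U, IsMonoClique G c b n (S u)) (hT : ∀ w ∈ W, IsMonoClique G c (!b) n (T w))
    (hcover : ∀ b' K, IsMonoClique G c b' n K → ∃ x ∈ K, x ∈ U ∨ x ∈ W)
    {u₀ a : α} (hU : IsTruncated n U S u₀ a)
    (hW : W.card ≤ 1 ∨ ∃ w₀ x₀, IsTruncated n W T w₀ x₀) : ¬ IsRamseyFor G n := by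
  intro hG
  have hWU : ∀ x ∈ W, x ∉ U := fun x hx => disjoint_right.1 hUW hx
  have two : ∀ {Z : Finset α} {R : α → Finset α} {z₀ y₀ : α}, IsTruncated n Z R z₀ y₀ →
      ∃ z₁ ∈ Z, ∃ z₂ ∈ Z, z₁ ≠ z₀ ∧ z₂ ≠ z₀ ∧ z₁ ≠ z₂ := by
    intro Z R z₀ y₀ h
    obtain ⟨z₁, h₁, z₂, h₂, hne⟩ := one_lt_card.1 (show 1 < (Z.erase z₀).card by
      rw [card_erase_of_mem h.mem, h.card]; omega)
    rw [mem_erase] at h₁ h₂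
    exact ⟨z₁, h₁.2, z₂, h₂.2, h₁.1, h₂.1, hne⟩
  obtain ⟨u₁, hu₁, u₂, hu₂, hu₁₀, hu₂₀, hu₁₂⟩ := two hU
  -- a colouring of the pairs between `U` and `W` in which no vertex dominates the other side
  obtain ⟨f, hfW, hfU⟩ : ∃ f : α → α → Bool,
      (∀ w ∈ W, ∃ u ∈ U, u ≠ u₀ ∧ f u w = b) ∧
      (W.card ≤ 1 ∨ ∃ w₀ x₀, IsTruncated n W T w₀ x₀ ∧
        ∀ u ∈ U, ∃ w ∈ W, w ≠ w₀ ∧ f u w = !b) := by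
    obtain hW | ⟨w₀, x₀, hW⟩ := hW
    · exact ⟨fun _ _ => b, fun w _ => ⟨u₁, hu₁, hu₁₀, rfl⟩, Or.inl hW⟩
    · obtain ⟨w₁, hw₁, w₂, hw₂, hw₁₀, hw₂₀, hw₁₂⟩ := two hW
      refine ⟨fun u w => if (u = u₁ ∧ w ≠ w₁) ∨ (u = u₂ ∧ w = w₁) then b else !b, fun w _ => ?_,
        Or.inr ⟨w₀, x₀, hW, fun u _ => ?_⟩⟩
      · by_cases hw : w = w₁
        · exact ⟨u₂, hu₂, hu₂₀, if_pos (Or.inr ⟨rfl, hw⟩)⟩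
        · exact ⟨u₁, hu₁, hu₁₀, if_pos (Or.inl ⟨rfl, hw⟩)⟩
      · by_cases hu : u = u₂
        · exact ⟨w₂, hw₂, hw₂₀, if_neg (by grind)⟩
        · exact ⟨w₁, hw₁, hw₁₀, if_neg (by grind)⟩
  obtain ⟨d, hdsymm, hdUU, hdWW, hdUW, hdUX, hdWX, hdXX⟩ : ∃ d : α → α → Bool,
      (∀ x y, d x y = d y x) ∧ (∀ x ∈ U, ∀ y ∈ U, d x y = !b) ∧
      (∀ x ∈ W, ∀ y ∈ W, d x y = b) ∧ (∀ x ∈ U, ∀ y ∈ W, d x y = f x y) ∧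
      (∀ u ∈ U, ∀ x, x ∉ U → x ∉ W → d u x = if x ∈ S u then !b else b) ∧
      (∀ w ∈ W, ∀ x, x ∉ U → x ∉ W → d w x = if x ∈ T w then b else !b) ∧
      (∀ x y, x ∉ U → x ∉ W → y ∉ U → y ∉ W → d x y = c x y) := by
    refine ⟨fun x y =>
      if x ∈ U then
        if y ∈ U then !b else if y ∈ W then f x y else if y ∈ S x then !b else b
      else if x ∈ W then
        if y ∈ U then f y x else if y ∈ W then b else if y ∈ T x then b else !b
      else
        if y ∈ U then if x ∈ S y then !b else b
        else if y ∈ W then if x ∈ T y then b else !b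
        else c x y, ?_, ?_, ?_, ?_, ?_, ?_, ?_⟩
    · intro x y
      have := hc x y
      dsimp only
      split_ifs <;> first | rfl | assumption
    all_goals
      intros
      simp_all
  have key : ∀ K, ¬ IsMonoClique G d b n K := by
    refine not_isMonoClique_of_recolouring hn hUW (hno b) hS hT hdUU ?_ ?_ hdXX (hcover b) ?_
    · intro u hu x hxU hxW h hx
      rw [hdUX u hu x hxU hxW, if_pos hx] at h
      simp at h
    · intro w hw x hxU hxW h
      by_contra hx
      rw [hdWX w hw x hxU hxW, if_neg hx] at h
      simp at h
    · refine hfU.imp_right ?_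
      rintro ⟨w₀, x₀, h, hrow⟩
      refine ⟨w₀, x₀, h, fun u hu => ?_⟩
      obtain ⟨w, hw, hw', hf⟩ := hrow u hu
      exact ⟨w, hw, hw', (hdUW u hu w hw).trans hf⟩
  have key' : ∀ K, ¬ IsMonoClique G d (!b) n K := by
    refine not_isMonoClique_of_recolouring hn hUW.symm (hno (!b)) hT (by simpa using hS)
      (by simpa using hdWW) ?_ ?_ (fun x y h₁ h₂ h₃ h₄ => hdXX x y h₂ h₁ h₄ h₃)
      (fun K hK => by simpa only [or_comm] using hcover (!b) K hK)
      (Or.inr ⟨u₀, a, hU, fun w hw => ?_⟩)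
    · intro w hw x hxW hxU h hx
      rw [hdWX w hw x hxU hxW, if_pos hx] at h
      simp at h
    · intro u hu x hxW hxU h
      by_contra hx
      rw [hdUX u hu x hxU hxW, if_neg hx] at h
      simp at h
    · obtain ⟨u, hu, hu', hf⟩ := hfW w hw
      exact ⟨u, hu, hu', by rw [hdsymm, hdUW u hu w hw, hf, Bool.not_not]⟩
  obtain ⟨b', K, hK⟩ := hG d hdsymm
  by_cases hb : b' = b
  · exact key K (hb ▸ hK)
  · exact key' K (Bool.eq_not_of_ne hb ▸ hK)

/-- Two distinct monochromatic `K n` of the same colour in a colouring without a monochromatic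
`K n + K (n - 1)` give a truncated clique meeting all monochromatic `K n` of that colour. -/
theorem exists_isTruncated {α : Type*} [DecidableEq α] {G : SimpleGraph α} {n : ℕ}
    {c : α → α → Bool} {b : Bool}
    (hno : ∀ S T, Disjoint S T → IsMonoClique G c b n S → ¬ IsMonoClique G c b (n - 1) T)
    {S S' : Finset α} (hS : IsMonoClique G c b n S) (hS' : IsMonoClique G c b n S')
    (hne : S ≠ S') :
    ∃ (U : Finset α) (R : α → Finset α) (u₀ a : α), U ⊆ S ∧ IsTruncated n U R u₀ a ∧
      (∀ u ∈ U, IsMonoClique G c b n (R u)) ∧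
      ∀ K, IsMonoClique G c b n K → ∃ x ∈ K, x ∈ U := by
  obtain ⟨a, ha, ha'⟩ : ∃ a ∈ S, a ∉ S' := by
    by_contra! h
    exact hne (eq_of_subset_of_card_le h (by rw [hS.1, hS'.1]))
  have hcard : (S.erase a).card = n - 1 := by rw [card_erase_of_mem ha, hS.1]
  have hcover : ∀ K, IsMonoClique G c b n K → ∃ x ∈ K, x ∈ S.erase a := by
    intro K hK
    by_contra! h
    exact hno K _ (disjoint_left.2 h) hK (hS.mono (erase_subset _ _) hcard)
  obtain ⟨u₀, hu₀', hu₀⟩ := hcover S' hS'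
  refine ⟨S.erase a, fun u => if u = u₀ then S' else S, u₀, a, erase_subset _ _,
    ⟨hu₀, hcard, by simpa using ha', fun u _ hu => ?_⟩, fun u _ => ?_, hcover⟩
  · rw [if_neg hu, insert_erase ha]
  · dsimp only
    split_ifs <;> assumption

/-- In a colouring without a monochromatic `K n + K (n - 1)` of a graph that is Ramsey for `K n`,
two monochromatic `K n` of the same colour coincide. -/
theorem IsRamseyFor.isMonoClique_unique {α : Type*} [DecidableEq α] {G : SimpleGraph α} {n : ℕ}
    (hG : IsRamseyFor G n) (hn : 4 ≤ n) {c : α → α → Bool} (hc : ∀ u v, c u v = c v u)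
    (hno : ∀ b S T, Disjoint S T → IsMonoClique G c b n S → ¬ IsMonoClique G c b (n - 1) T)
    {b : Bool} {S S' : Finset α} (hS : IsMonoClique G c b n S)
    (hS' : IsMonoClique G c b n S') : S = S' := by
  by_contra hne
  obtain ⟨U, R, u₀, a, -, htr, hR, hU⟩ := exists_isTruncated (hno b) hS hS' hne
  suffices h : ∃ (W : Finset α) (T : α → Finset α), Disjoint U W ∧
      (∀ w ∈ W, IsMonoClique G c (!b) n (T w)) ∧
      (∀ K, IsMonoClique G c (!b) n K → ∃ x ∈ K, x ∈ U ∨ x ∈ W) ∧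
      (W.card ≤ 1 ∨ ∃ w₀ x₀, IsTruncated n W T w₀ x₀) by
    obtain ⟨W, T, hUW, hT, hW, hW'⟩ := h
    refine not_isRamseyFor_of_isTruncated hn hc hno hUW hR hT (fun b' K hK => ?_) htr hW' hG
    by_cases hb : b' = b
    · obtain ⟨x, hx, hxU⟩ := hU K (hb ▸ hK)
      exact ⟨x, hx, Or.inl hxU⟩
    · exact hW K (Bool.eq_not_of_ne hb ▸ hK)
  by_cases h₁ : ∃ T, IsMonoClique G c (!b) n T ∧ Disjoint U T
  · obtain ⟨T, hT, hUT⟩ := h₁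
    by_cases h₂ : ∃ T', IsMonoClique G c (!b) n T' ∧ Disjoint U T' ∧ T ≠ T'
    · obtain ⟨T', hT', -, hTT'⟩ := h₂
      obtain ⟨W, Q, w₀, x₀, hWT, hW, hQ, hcov⟩ :=
        exists_isTruncated (hno (!b)) hT hT' hTT'
      refine ⟨W, Q, hUT.mono_right hWT, hQ, fun K hK => ?_, Or.inr ⟨w₀, x₀, hW⟩⟩
      obtain ⟨x, hx, hxW⟩ := hcov K hK
      exact ⟨x, hx, Or.inr hxW⟩
    · push Not at h₂
      obtain ⟨w, hw⟩ := card_pos.1 (show 0 < T.card by rw [hT.1]; omega)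
      refine ⟨{w}, fun _ => T, hUT.mono_right (singleton_subset_iff.2 hw), fun _ _ => hT,
        fun K hK => ?_, Or.inl (card_singleton w).le⟩
      by_cases hUK : Disjoint U K
      · exact ⟨w, h₂ K hK hUK ▸ hw, Or.inr (mem_singleton_self w)⟩
      · obtain ⟨x, hx, hxK⟩ := not_disjoint_iff.1 hUK
        exact ⟨x, hxK, Or.inl hx⟩
  · push Not at h₁
    refine ⟨∅, fun _ => ∅, disjoint_empty_right _, by simp, fun K hK => ?_, Or.inl (by simp)⟩
    obtain ⟨x, hx, hxK⟩ := not_disjoint_iff.1 (h₁ K hK)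
    exact ⟨x, hxK, Or.inl hx⟩

theorem no_two_mono_Kn_intersect_in_two (n : ℕ) (hn : 4 ≤ n)
    {α : Type*} [Fintype α] [DecidableEq α] (G : SimpleGraph α) (hG : IsRamseyFor G n)
    (c : α → α → Bool) (hc : ∀ u v, c u v = c v u)
    (hno : ¬ ∃ b S T, Disjoint S T ∧ IsMonoClique G c b n S ∧
      IsMonoClique G c b (n - 1) T) :
    ¬ ∃ (S S' : Finset α) (b b' : Bool), IsMonoClique G c b n S ∧
      IsMonoClique G c b' n S' ∧ (S ∩ S').card = 2 := by
  rintro ⟨S, S', b, b', hS, hS', h⟩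
  obtain ⟨u, hu, v, hv, huv⟩ := one_lt_card.1 (show 1 < (S ∩ S').card by omega)
  rw [mem_inter] at hu hv
  obtain rfl : b = b' :=
    (hS.2.2 u hu.1 v hv.1 huv).symm.trans (hS'.2.2 u hu.2 v hv.2 huv)
  have heq : S = S' := hG.isMonoClique_unique hn hc
    (fun b S T hST hS hT => hno ⟨b, S, T, hST, hS, hT⟩) hS hS'
  rw [← heq, inter_self, hS.1] at h
  omega
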